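/- arXiv:2202.02008 — 4 statements merged into one kernel-verified Lean document; each statement's English description precedes it below -/
import Mathlib

section
/- Let (B, L, θ, I_a) be a generalized Boolean dynamical system, let α = α₁⋯α_n (n ≥ 1) be a word over L, and for each 1 ≤ i ≤ n let η_i be an ultrafilter in the ideal I_{α_i}. Suppose that for every 1 ≤ i < n the upward closure of η_i in B equals {A ∈ B : θ_{α_{i+1}}(A) ∈ η_{i+1}}. Then for all 1 ≤ i < j ≤ n and every A ∈ I_{α_i}: A ∈ η_i if and only if θ_{α_{i+1}⋯α_j}(A) ∈ η_j. (This is the key compatibility fact used to compute intersections of cylinder sets N(α,A) ∩ N(β,B) in the boundary path space.) -/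
/-- An action on a generalized Boolean algebra: a Boolean homomorphism sending `⊥` to `⊥`. -/
def IsBoolAction {B : Type*} [GeneralizedBooleanAlgebra B] (θ : B → B) : Prop :=
  θ ⊥ = ⊥ ∧ (∀ a b : B, θ (a ⊓ b) = θ a ⊓ θ b) ∧ (∀ a b : B, θ (a ⊔ b) = θ a ⊔ θ b) ∧
    (∀ a b : B, θ (a \ b) = θ a \ θ b)

/-- An ideal of a generalized Boolean algebra: nonempty, downward closed, closed under `⊔`. -/
def IsIdealSet {B : Type*} [GeneralizedBooleanAlgebra B] (I : Set B) : Prop :=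
  I.Nonempty ∧ (∀ a ∈ I, ∀ b : B, b ≤ a → b ∈ I) ∧ ∀ a ∈ I, ∀ b ∈ I, a ⊔ b ∈ I

/-- A filter in the subposet `I` (an ideal, whose least element is `⊥`): a nonempty subset of `I`
not containing `⊥`, upward closed in `I`, and downward directed. -/
def IsFilterIn {B : Type*} [GeneralizedBooleanAlgebra B] (I : Set B) (ξ : Set B) : Prop :=
  ξ ⊆ I ∧ ξ.Nonempty ∧ ⊥ ∉ ξ ∧
    (∀ x ∈ ξ, ∀ y ∈ I, x ≤ y → y ∈ ξ) ∧
    ∀ x ∈ ξ, ∀ y ∈ ξ, ∃ z ∈ ξ, z ≤ x ∧ z ≤ y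

/-- An ultrafilter in the subposet `I`: a maximal filter in `I`. -/
def IsUltrafilterIn {B : Type*} [GeneralizedBooleanAlgebra B] (I : Set B) (ξ : Set B) : Prop :=
  IsFilterIn I ξ ∧ ∀ ζ : Set B, IsFilterIn I ζ → ξ ⊆ ζ → ζ = ξ

/-- `thetaWord θ [a₁, …, aₙ] = θ aₙ ∘ ⋯ ∘ θ a₁`, with the empty word acting as the identity. -/
def thetaWord {B L : Type*} [GeneralizedBooleanAlgebra B] (θ : L → B → B) : List L → B → B
  | [] => id
  | a :: rest => fun A => thetaWord θ rest (θ a A)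

/-- The ideal `I_α` associated with a word `α`: `I_∅ := B`, `I_a := Iof a` for a letter `a`, and
`I_{a α'} := {A : ∃ C ∈ Iof a, A ⊆ θ_{α'}(C)}` for longer words. -/
def idealWord {B L : Type*} [GeneralizedBooleanAlgebra B] (θ : L → B → B) (Iof : L → Set B) :
    List L → Set B
  | [] => Set.univ
  | [a] => Iof a
  | a :: rest => {A : B | ∃ C ∈ Iof a, A ≤ thetaWord θ rest C}

/-- An element of `I` belongs to a filter in `I` iff it lies above some member of the filter. -/
theorem IsFilterIn.exists_le_iff_mem {B : Type*} [GeneralizedBooleanAlgebra B] {I ξ : Set B}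
    (hξ : IsFilterIn I ξ) {A : B} (hA : A ∈ I) : (∃ C ∈ ξ, C ≤ A) ↔ A ∈ ξ :=
  ⟨fun ⟨C, hC, hCA⟩ => hξ.2.2.2.1 C hC A hA hCA, fun h => ⟨A, h, le_rfl⟩⟩

/-- Membership is transported along a composable family of filters: the version of `stmt2` with
the second index written as `i + k`. -/
theorem mem_iff_thetaWord_mem {B L : Type*} [GeneralizedBooleanAlgebra B]
    (θ : L → B → B) (Iof : L → Set B)
    (hRsub : ∀ a : L, ∀ A : B, (∃ C : B, A ≤ θ a C) → A ∈ Iof a)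
    (α : List L)
    (η : Fin α.length → Set B)
    (hη : ∀ i : Fin α.length, IsFilterIn (Iof (α.get i)) (η i))
    (hcomp : ∀ (i : ℕ) (h : i + 1 < α.length),
      {A : B | ∃ C ∈ η ⟨i, Nat.lt_of_succ_lt h⟩, C ≤ A}
        = {A : B | θ (α.get ⟨i + 1, h⟩) A ∈ η ⟨i + 1, h⟩})
    (k i j : ℕ) (hi : i < α.length) (hj : j < α.length) (hij : j = i + k)
    (A : B) (hA : A ∈ Iof (α.get ⟨i, hi⟩)) :
    A ∈ η ⟨i, hi⟩ ↔ thetaWord θ ((α.drop (i + 1)).take k) A ∈ η ⟨j, hj⟩ := by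
  induction k generalizing i A with
  | zero =>
    subst hij
    simp [thetaWord]
  | succ k ih =>
    have hi' : i + 1 < α.length := by omega
    rw [← (hη ⟨i, hi⟩).exists_le_iff_mem hA, List.drop_eq_getElem_cons hi', List.take_succ_cons]
    exact (Set.ext_iff.mp (hcomp i hi') A).trans
      (ih (i + 1) hi' (by omega) _ (hRsub _ _ ⟨A, le_rfl⟩))

/-- for a composable family of ultrafilters along a word `α`, membership
`A ∈ ηᵢ` is equivalent to `θ_{α_{i+1}⋯α_j}(A) ∈ η_j` for all `i < j` and `A ∈ I_{αᵢ}`. -/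
theorem stmt2 {B L : Type*} [GeneralizedBooleanAlgebra B]
    (θ : L → B → B) (Iof : L → Set B)
    (hact : ∀ a : L, IsBoolAction (θ a))
    (hideal : ∀ a : L, IsIdealSet (Iof a))
    (hRsub : ∀ a : L, ∀ A : B, (∃ C : B, A ≤ θ a C) → A ∈ Iof a)
    (α : List L)
    (η : Fin α.length → Set B)
    (hη : ∀ i : Fin α.length, IsUltrafilterIn (Iof (α.get i)) (η i))
    (hcomp : ∀ (i : ℕ) (h : i + 1 < α.length),
      {A : B | ∃ C ∈ η ⟨i, Nat.lt_of_succ_lt h⟩, C ≤ A}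
        = {A : B | θ (α.get ⟨i + 1, h⟩) A ∈ η ⟨i + 1, h⟩}) :
    ∀ i j : Fin α.length, i < j → ∀ A ∈ Iof (α.get i),
      (A ∈ η i ↔ thetaWord θ ((α.drop ((i : ℕ) + 1)).take ((j : ℕ) - (i : ℕ))) A ∈ η j) := by
  intro i j hij A hA
  exact mem_iff_thetaWord_mem θ Iof hRsub α η (fun i => (hη i).1) hcomp _ i j i.2 j.2
    (by have := Fin.lt_def.mp hij; omega) A hA
end

section
/- Let A be a commutative C*-algebra and let B denote the set of all projections of A. Then B, partially ordered by p ≤ q ⟺ pq = p, is a generalized Boolean algebra with least element 0 in which the meet of p and q is pq, the join of p and q is p + q − pq, and the relative complement of q in p is p − pq. (Formally: there is a GeneralizedBooleanAlgebra structure on the type of projections of A whose order, bot, inf, sup, and sdiff are as described.) -/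
section CommutingProjections

variable {A : Type*} [NonUnitalCommRing A] [StarRing A]

/-- The generalized Boolean algebra of projections of a non-unital commutative star ring. -/
abbrev projectionGeneralizedBooleanAlgebra :
    GeneralizedBooleanAlgebra {p : A // star p = p ∧ p * p = p} where
  le p q := (p : A) * q = p
  le_refl p := p.2.2
  le_trans p q r hpq hqr := by
    rw [← hpq, mul_assoc, hqr]
  le_antisymm p q hpq hqp := Subtype.ext (by rw [← hpq, mul_comm, hqp])
  bot := ⟨0, by simp⟩
  inf p q := ⟨p * q, by simp [p.2.1, q.2.1], by
    rw [mul_mul_mul_comm, p.2.2, q.2.2]⟩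
  sup p q := ⟨p + q - p * q, by simp [p.2.1, q.2.1], by
    obtain ⟨p, -, hp⟩ := p
    obtain ⟨q, -, hq⟩ := q
    have hp' (x : A) : p * (p * x) = p * x := by rw [← mul_assoc, hp]
    simp only [mul_add, mul_sub, mul_comm, mul_left_comm, hp, hq, hp']
    abel⟩
  sdiff p q := ⟨p - p * q, by simp [p.2.1, q.2.1], by
    obtain ⟨p, -, hp⟩ := p
    obtain ⟨q, -, hq⟩ := q
    have hp' (x : A) : p * (p * x) = p * x := by rw [← mul_assoc, hp]
    simp only [mul_sub, mul_comm, mul_left_comm, hp, hq, hp']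
    abel⟩
  inf_le_left p q := by
    change (p : A) * q * p = p * q
    rw [mul_right_comm, p.2.2]
  inf_le_right p q := by
    change (p : A) * q * q = p * q
    rw [mul_assoc, q.2.2]
  le_inf p q r hpq hpr := by
    change (p : A) * (q * r) = p
    rw [← mul_assoc, hpq, hpr]
  le_sup_left p q := by
    change (p : A) * (p + q - p * q) = p
    rw [mul_sub, mul_add, ← mul_assoc, p.2.2, add_sub_cancel_right]
  le_sup_right p q := by
    change (q : A) * (p + q - p * q) = q
    rw [mul_sub, mul_add, mul_left_comm, q.2.2, mul_comm, add_sub_cancel_left]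
  sup_le p q r hpr hqr := by
    change ((p : A) + q - p * q) * r = p + q - p * q
    rw [sub_mul, add_mul, mul_assoc, hpr, hqr]
  le_sup_inf p q r := by
    obtain ⟨p, -, hp⟩ := p
    obtain ⟨q, -, hq⟩ := q
    obtain ⟨r, -, hr⟩ := r
    change (p + q - p * q) * (p + r - p * r) * (p + q * r - p * (q * r)) =
      (p + q - p * q) * (p + r - p * r)
    have hp' (x : A) : p * (p * x) = p * x := by rw [← mul_assoc, hp]
    have hq' (x : A) : q * (q * x) = q * x := by rw [← mul_assoc, hq]
    simp only [mul_add, mul_sub, mul_comm, mul_left_comm, hp, hr, hp', hq']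
    abel
  sup_inf_sdiff p q := Subtype.ext <| by
    change (p : A) * q + (p - p * q) - p * q * (p - p * q) = p
    rw [mul_sub, mul_mul_mul_comm, mul_right_comm, p.2.2, q.2.2]
    abel
  inf_inf_sdiff p q := Subtype.ext <| by
    change (p : A) * q * (p - p * q) = 0
    rw [mul_sub, mul_mul_mul_comm, mul_right_comm, p.2.2, q.2.2, sub_self]

end CommutingProjections


/-- the projections of a commutative C*-algebra form a generalized Boolean
algebra, ordered by `p ≤ q ↔ pq = p`, with least element `0`, meet `pq`, join `p + q - pq`,
and relative complement `p - pq`. -/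
theorem stmt6 {A : Type*} [NonUnitalCommCStarAlgebra A] :
    ∃ inst : GeneralizedBooleanAlgebra {p : A // star p = p ∧ p * p = p},
      (∀ p q : {p : A // star p = p ∧ p * p = p}, inst.le p q ↔ (p : A) * q = p) ∧
      ((inst.bot : {p : A // star p = p ∧ p * p = p}) : A) = 0 ∧
      (∀ p q : {p : A // star p = p ∧ p * p = p}, ((inst.inf p q : _) : A) = (p : A) * q) ∧
      (∀ p q : {p : A // star p = p ∧ p * p = p},
        ((inst.sup p q : _) : A) = (p : A) + q - (p : A) * q) ∧
      (∀ p q : {p : A // star p = p ∧ p * p = p},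
        ((inst.sdiff p q : _) : A) = (p : A) - (p : A) * q) := by
  exact ⟨projectionGeneralizedBooleanAlgebra, fun _ _ => Iff.rfl, rfl, fun _ _ => rfl,
    fun _ _ => rfl, fun _ _ => rfl⟩
end

section
/- Let A be a commutative C*-algebra which is generated, as a C*-algebra, by its projections, and let B be the generalized Boolean algebra of projections of A (ordered by p ≤ q ⟺ pq = p, with meet pq, join p+q−pq, relative complement p−pq, least element 0). Let B̂ be the set of all ultrafilters of B, topologized by the topology generated by the sets Z(p) := {ξ ∈ B̂ : p ∈ ξ} for p ∈ B. Then there is an isometric *-isomorphism Φ from A onto C₀(B̂, ℂ), the algebra of continuous complex-valued functions on B̂ vanishing at infinity, such that Φ(p) = 1_{Z(p)} (the characteristic function of Z(p)) for every projection p of A. -/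
open scoped ZeroAtInfty

namespace Stmt7

variable (A : Type*) [NonUnitalCommCStarAlgebra A]

/-- The projections of `A`. -/
abbrev Proj := {p : A // star p = p ∧ p * p = p}

/-- The order `p ≤ q ↔ pq = p` on projections. -/
def leP (p q : Proj A) : Prop := (p : A) * q = p

/-- The zero projection. -/
def zeroP : Proj A := ⟨0, by simp⟩

/-- A filter in the poset of projections of `A` (least element `0`): a nonempty subset not
containing `0`, upward closed, and downward directed. -/
def IsFilt (ξ : Set (Proj A)) : Prop :=
  ξ.Nonempty ∧ zeroP A ∉ ξ ∧
    (∀ p ∈ ξ, ∀ q : Proj A, leP A p q → q ∈ ξ) ∧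
    ∀ p ∈ ξ, ∀ q ∈ ξ, ∃ z ∈ ξ, leP A z p ∧ leP A z q

/-- An ultrafilter in the poset of projections of `A`: a maximal filter. -/
def IsUlt (ξ : Set (Proj A)) : Prop :=
  IsFilt A ξ ∧ ∀ ζ : Set (Proj A), IsFilt A ζ → ξ ⊆ ζ → ζ = ξ

/-- The Stone dual `B̂` of the generalized Boolean algebra of projections of `A`: the set of
all ultrafilters of projections. -/
def Bhat := {ξ : Set (Proj A) // IsUlt A ξ}

/-- The topology on `B̂` generated by the sets `Z(p) = {ξ : p ∈ ξ}`. -/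
instance : TopologicalSpace (Bhat A) :=
  TopologicalSpace.generateFrom {S : Set (Bhat A) | ∃ p : Proj A, S = {ξ : Bhat A | p ∈ ξ.val}}

open WeakDual Filter Topology

variable {A}

@[simp]
theorem coe_zeroP : ((zeroP A : Proj A) : A) = 0 := rfl

/-- The product of two projections. -/
def mulP (p q : Proj A) : Proj A :=
  ⟨(p : A) * q, by rw [star_mul, p.2.1, q.2.1, mul_comm],
    by rw [mul_mul_mul_comm, p.2.2, q.2.2]⟩

/-- The relative complement `p - pq` of two projections. -/
def diffP (p q : Proj A) : Proj A :=
  ⟨(p : A) - p * q, by rw [star_sub, star_mul, p.2.1, q.2.1, mul_comm],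
    by
      have h₁ : (p : A) * (p * q) = p * q := by rw [← mul_assoc, p.2.2]
      have h₂ : (p : A) * q * p = p * q := by rw [mul_comm, h₁]
      have h₃ : (p : A) * q * (p * q) = p * q := (mulP p q).2.2
      rw [sub_mul, mul_sub, mul_sub, p.2.2, h₁, h₂, h₃, sub_self, sub_zero]⟩

@[simp]
theorem coe_mulP (p q : Proj A) : (mulP p q : A) = p * q := rfl

@[simp]
theorem coe_diffP (p q : Proj A) : (diffP p q : A) = p - p * q := rfl

theorem IsFilt.mulP_mem {ξ : Set (Proj A)} (hξ : IsFilt A ξ) {p q : Proj A} (hp : p ∈ ξ)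
    (hq : q ∈ ξ) : mulP p q ∈ ξ := by
  obtain ⟨z, hz, hzp, hzq⟩ := hξ.2.2.2 p hp q hq
  refine hξ.2.2.1 z hz _ ?_
  change (z : A) * (p * q) = z
  rw [← mul_assoc, show (z : A) * p = z from hzp, show (z : A) * q = z from hzq]

variable (A) in
/-- The characters of the unitization of `A`. -/
abbrev Char : Type _ := ↥(characterSpace ℂ (Unitization ℂ A))

theorem Char.continuous_apply (b : Unitization ℂ A) : Continuous fun χ : Char A => χ b :=
  (WeakDual.eval_continuous b).comp continuous_subtype_val

/-- The restriction to `A` of a character of its unitization. -/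
noncomputable def Char.res (χ : Char A) : A →⋆ₙₐ[ℂ] ℂ where
  toFun a := χ (a : Unitization ℂ A)
  map_smul' c a := by simp
  map_zero' := by simp
  map_add' a b := by simp
  map_mul' a b := by simp
  map_star' a := by rw [Unitization.inr_star, map_star]

theorem Char.res_apply (χ : Char A) (a : A) : χ.res a = χ (a : Unitization ℂ A) := rfl

theorem Char.continuous_res_apply (a : A) : Continuous fun χ : Char A => χ.res a :=
  Char.continuous_apply _

theorem Char.continuous_res (χ : Char A) : Continuous χ.res :=
  (map_continuous χ).comp Unitization.continuous_inr

theorem Char.apply_eq (χ : Char A) (b : Unitization ℂ A) : χ b = b.fst + χ.res b.snd := by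
  conv_lhs => rw [← Unitization.inl_fst_add_inr_snd_eq b]
  rw [map_add, Char.res_apply]
  congr 1
  exact AlgHomClass.commutes χ b.fst

theorem Char.norm_res_le (χ : Char A) (a : A) : ‖χ.res a‖ ≤ ‖a‖ :=
  NonUnitalStarAlgHom.norm_apply_le χ.res a

theorem apply_eq_zero_or_one (φ : A →⋆ₙₐ[ℂ] ℂ) (p : Proj A) : φ p = 0 ∨ φ p = 1 := by
  have h : φ p * φ p = φ p := by rw [← map_mul, p.2.2]
  rcases eq_or_ne (φ p) 0 with h0 | h0
  · exact .inl h0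
  · exact .inr (mul_right_cancel₀ h0 (by rw [h, one_mul]))

theorem exists_char_apply_ne_zero {a : A} (ha : a ≠ 0) : ∃ χ : Char A, χ.res a ≠ 0 := by
  by_contra! h
  refine ha (Unitization.inr_injective (R := ℂ) ((gelfandTransform_bijective _).1 ?_))
  ext χ
  simpa using! h χ

/-- The projections on which `φ` takes the value `1`. -/
def ones (φ : A →⋆ₙₐ[ℂ] ℂ) : Set (Proj A) := {p | φ p = 1}

theorem isUlt_ones {φ : A →⋆ₙₐ[ℂ] ℂ} (h : (ones φ).Nonempty) : IsUlt A (ones φ) := by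
  refine ⟨⟨h, by simp [ones], fun p hp q hpq => ?_, fun p hp q hq => ?_⟩, fun ζ hζ hle => ?_⟩
  · have h' : φ p * φ q = φ p := by rw [← map_mul, show (p : A) * q = p from hpq]
    rw [show φ p = 1 from hp, one_mul] at h'
    exact h'
  · refine ⟨mulP p q, ?_, ?_, ?_⟩
    · change φ (p * q) = 1
      rw [map_mul, show φ p = 1 from hp, show φ q = 1 from hq, one_mul]
    · change (p : A) * q * p = p * q
      rw [mul_comm, ← mul_assoc, p.2.2]
    · change (p : A) * q * q = p * q
      rw [mul_assoc, q.2.2]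
  · refine Set.Subset.antisymm (fun q hq => ?_) hle
    rcases apply_eq_zero_or_one φ q with h0 | h1
    · obtain ⟨p, hp⟩ := h
      have hd : diffP p q ∈ ones φ := by
        change φ (p - p * q) = 1
        rw [map_sub, map_mul, h0, mul_zero, sub_zero]
        exact hp
      have hz : mulP (diffP p q) q = zeroP A := by
        apply Subtype.ext
        rw [coe_mulP, coe_diffP, sub_mul, mul_assoc, q.2.2, sub_self, coe_zeroP]
      exact absurd (hz ▸ hζ.mulP_mem (hle hd) hq) hζ.2.1
    · exact h1

theorem IsUlt.exists_char {ξ : Set (Proj A)} (hξ : IsUlt A ξ) : ∃ χ : Char A, ones χ.res = ξ := by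
  have : Nonempty ξ := hξ.1.1.to_subtype
  let t : ξ → Set (Char A) := fun p => {χ | χ.res p.1 = 1}
  have hcl : ∀ p, IsClosed (t p) := fun p =>
    isClosed_eq (Char.continuous_res_apply _) continuous_const
  have hdir : Directed (· ⊇ ·) t := fun p q => by
    refine ⟨⟨mulP p.1 q.1, hξ.1.mulP_mem p.2 q.2⟩, ?_⟩
    have key (χ : Char A) (hχ : χ.res (p.1.1 * q.1.1) = 1) : χ.res p.1 = 1 ∧ χ.res q.1 = 1 := by
      rw [map_mul] at hχ
      rcases apply_eq_zero_or_one χ.res p.1 with h | h <;>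
        rcases apply_eq_zero_or_one χ.res q.1 with h' | h' <;> simp_all
    exact ⟨fun χ hχ => (key χ hχ).1, fun χ hχ => (key χ hχ).2⟩
  have hne (p : ξ) : (t p).Nonempty := by
    have hp : (p.1 : A) ≠ 0 := fun h => hξ.1.2.1 (by
      rw [show zeroP A = p.1 from Subtype.ext h.symm]; exact p.2)
    obtain ⟨χ, hχ⟩ := exists_char_apply_ne_zero hp
    exact ⟨χ, (apply_eq_zero_or_one χ.res p.1).resolve_left hχ⟩
  obtain ⟨χ, hχ⟩ := IsCompact.nonempty_iInter_of_directed_nonempty_isCompact_isClosed t hdir hne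
    (fun p => (hcl p).isCompact) hcl
  have hle : ξ ⊆ ones χ.res := fun p hp => Set.mem_iInter.1 hχ ⟨p, hp⟩
  exact ⟨χ, hξ.2 _ (isUlt_ones (hξ.1.1.mono hle)).1 hle⟩

/-- A character of the unitization whose set of projections of value `1` is `ξ`. -/
noncomputable def Bhat.char (ξ : Bhat A) : Char A := ξ.2.exists_char.choose

theorem Bhat.mem_iff {ξ : Bhat A} {p : Proj A} : p ∈ ξ.1 ↔ ξ.char.res p = 1 := by
  conv_lhs => rw [← ξ.2.exists_char.choose_spec]
  rfl

theorem Bhat.notMem_iff {ξ : Bhat A} {p : Proj A} : p ∉ ξ.1 ↔ ξ.char.res p = 0 := by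
  rw [Bhat.mem_iff]
  rcases apply_eq_zero_or_one ξ.char.res p with h | h <;> simp [h]

theorem isOpen_Z (p : Proj A) : IsOpen {ξ : Bhat A | p ∈ ξ.1} :=
  TopologicalSpace.isOpen_generateFrom_of_mem ⟨p, rfl⟩

theorem isClopen_Z (p : Proj A) : IsClopen {ξ : Bhat A | p ∈ ξ.1} := by
  refine ⟨⟨isOpen_iff_forall_mem_open.2 fun ξ hξ => ?_⟩, isOpen_Z p⟩
  obtain ⟨q, hq⟩ := ξ.2.1.1
  have hξ' : ξ.char.res p = 0 := Bhat.notMem_iff.1 hξ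
  refine ⟨{η | diffP q p ∈ η.1}, fun η hη hp => ?_, isOpen_Z _, ?_⟩
  · have h₁ := Bhat.mem_iff.1 hη
    rw [coe_diffP, map_sub, map_mul, Bhat.mem_iff.1 hp, mul_one, sub_self] at h₁
    exact zero_ne_one h₁
  · change diffP q p ∈ ξ.1
    rw [Bhat.mem_iff, coe_diffP, map_sub, map_mul, hξ', mul_zero, sub_zero, Bhat.mem_iff.1 hq]

variable (A) in
/-- The hypothesis that the projections generate `A` as a C*-algebra. -/
def GeneratedByProj : Prop :=
  closure ((NonUnitalStarAlgebra.adjoin ℂ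
    {p : A | star p = p ∧ p * p = p} : NonUnitalStarSubalgebra ℂ A) : Set A) = Set.univ

theorem GeneratedByProj.ext (hgen : GeneratedByProj A) {φ ψ : A →⋆ₙₐ[ℂ] ℂ} (hφ : Continuous φ)
    (hψ : Continuous ψ) (h : ∀ p : Proj A, φ p = ψ p) : φ = ψ := by
  have hle : NonUnitalStarAlgebra.adjoin ℂ {p : A | star p = p ∧ p * p = p} ≤
      NonUnitalStarAlgHom.equalizer φ ψ :=
    NonUnitalStarAlgebra.adjoin_le fun p hp => h ⟨p, hp⟩
  exact DFunLike.coe_injective (Continuous.ext_on (dense_iff_closure_eq.2 hgen) hφ hψ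
    fun a ha => hle ha)

theorem GeneratedByProj.ones_nonempty (hgen : GeneratedByProj A) {χ : Char A} {a : A}
    (ha : χ.res a ≠ 0) : (ones χ.res).Nonempty := by
  by_contra h
  have h0 : χ.res = 0 := hgen.ext χ.continuous_res continuous_const fun p =>
    (apply_eq_zero_or_one χ.res p).resolve_right fun h1 => h ⟨p, h1⟩
  exact ha (by rw [h0]; rfl)

variable (A) in
/-- The characters taking the value `1` on some projection. -/
abbrev NonzeroChar := {χ : Char A // (ones χ.res).Nonempty}

/-- The ultrafilter of projections attached to a character. -/
def NonzeroChar.ult (χ : NonzeroChar A) : Bhat A := ⟨_, isUlt_ones χ.2⟩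

theorem GeneratedByProj.res_char_ult (hgen : GeneratedByProj A) (χ : NonzeroChar A) :
    χ.ult.char.res = χ.1.res := by
  refine hgen.ext (Char.continuous_res _) (Char.continuous_res _) fun p => ?_
  rcases apply_eq_zero_or_one χ.1.res p with h0 | h1
  · rw [h0]
    exact Bhat.notMem_iff.1 fun hp => zero_ne_one (h0.symm.trans hp)
  · rw [h1]
    exact Bhat.mem_iff.1 h1

theorem NonzeroChar.continuous_ult : Continuous (NonzeroChar.ult (A := A)) := by
  refine continuous_generateFrom_iff.2 ?_
  rintro _ ⟨p, rfl⟩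
  have : NonzeroChar.ult ⁻¹' {ξ : Bhat A | p ∈ ξ.1} = {χ : NonzeroChar A | χ.1.res p ≠ 0} := by
    ext χ
    change χ.1.res p = 1 ↔ χ.1.res p ≠ 0
    rcases apply_eq_zero_or_one χ.1.res p with h | h <;> simp [h]
  rw [this]
  exact isOpen_ne_fun ((Char.continuous_res_apply _).comp continuous_subtype_val) continuous_const

theorem Bhat.char_nonempty (ξ : Bhat A) : (ones ξ.char.res).Nonempty :=
  ξ.2.1.1.mono fun _ hp => Bhat.mem_iff.1 hp

theorem Bhat.ult_char (ξ : Bhat A) : NonzeroChar.ult ⟨ξ.char, ξ.char_nonempty⟩ = ξ :=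
  Subtype.ext (Set.ext fun _ => Bhat.mem_iff.symm)

theorem Bhat.char_apply_proj (p : Proj A) (ξ : Bhat A) :
    ξ.char.res p = Set.indicator {ζ : Bhat A | p ∈ ζ.val} (fun _ => (1 : ℂ)) ξ := by
  by_cases h : p ∈ ξ.1
  · rw [Set.indicator_of_mem (by exact h), Bhat.mem_iff.1 h]
  · rw [Set.indicator_of_notMem (by exact h), Bhat.notMem_iff.1 h]

theorem GeneratedByProj.continuous_char_apply (hgen : GeneratedByProj A) (a : A) :
    Continuous fun ξ : Bhat A => ξ.char.res a := by
  have hadj (b : A) (hb : b ∈ NonUnitalStarAlgebra.adjoin ℂ {p : A | star p = p ∧ p * p = p}) :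
      Continuous fun ξ : Bhat A => ξ.char.res b := by
    induction hb using NonUnitalStarAlgebra.adjoin_induction with
    | mem p hp =>
      refine ((isClopen_Z ⟨p, hp⟩).continuous_indicator
        (continuous_const (y := (1 : ℂ)))).congr fun ξ => ?_
      exact (Bhat.char_apply_proj ⟨p, hp⟩ ξ).symm
    | add x y _ _ hx hy => simpa only [map_add] using! hx.add hy
    | zero => simpa only [map_zero] using! continuous_const
    | mul x y _ _ hx hy => simpa only [map_mul] using! hx.mul hy
    | smul r x _ hx => simpa only [map_smul] using! hx.const_smul r
    | star x _ hx => simpa only [map_star] using! hx.star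
  refine continuous_of_uniform_approx_of_continuous fun u hu => ?_
  obtain ⟨ε, hε, hεu⟩ := Metric.mem_uniformity_dist.1 hu
  have ha : a ∈ closure _ := hgen.symm ▸ Set.mem_univ a
  obtain ⟨b, hb, hab⟩ := Metric.mem_closure_iff.1 ha ε hε
  refine ⟨_, hadj b hb, fun ξ => hεu ?_⟩
  rw [dist_eq_norm, ← map_sub]
  exact (ξ.char.norm_res_le _).trans_lt (by rwa [← dist_eq_norm])

theorem GeneratedByProj.tendsto_char_apply (hgen : GeneratedByProj A) (a : A) :
    Tendsto (fun ξ : Bhat A => ξ.char.res a) (cocompact (Bhat A)) (𝓝 0) := by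
  refine Metric.tendsto_nhds.2 fun ε hε => mem_cocompact'.2 ?_
  have hK : IsCompact {χ : NonzeroChar A | ε ≤ ‖χ.1.res a‖} := by
    rw [IsEmbedding.subtypeVal.isCompact_iff]
    have himg : Subtype.val '' {χ : NonzeroChar A | ε ≤ ‖χ.1.res a‖} =
        {χ : Char A | ε ≤ ‖χ.res a‖} := by
      ext χ
      refine ⟨fun ⟨χ', h, e⟩ => e ▸ h, fun h => ⟨⟨χ, hgen.ones_nonempty (a := a) ?_⟩, h, rfl⟩⟩
      exact norm_pos_iff.1 (hε.trans_le h)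
    rw [himg]
    exact (isClosed_le continuous_const (Char.continuous_res_apply a).norm).isCompact
  refine ⟨_, hK.image NonzeroChar.continuous_ult, fun ξ hξ => ?_⟩
  refine ⟨⟨ξ.char, ξ.char_nonempty⟩, ?_, ξ.ult_char⟩
  simpa using! hξ

/-- The Gelfand transform of `A`, viewed as functions on the ultrafilters of projections. -/
noncomputable def GeneratedByProj.transform (hgen : GeneratedByProj A) :
    A →⋆ₙₐ[ℂ] C₀(Bhat A, ℂ) where
  toFun a := ⟨⟨fun ξ => ξ.char.res a, hgen.continuous_char_apply a⟩, hgen.tendsto_char_apply a⟩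
  map_smul' c a := by ext ξ; exact map_smul ξ.char.res c a
  map_zero' := by ext ξ; exact map_zero ξ.char.res
  map_add' a b := by ext ξ; exact map_add ξ.char.res a b
  map_mul' a b := by ext ξ; exact map_mul ξ.char.res a b
  map_star' a := by ext ξ; exact map_star ξ.char.res a

theorem GeneratedByProj.transform_apply (hgen : GeneratedByProj A) (a : A) (ξ : Bhat A) :
    hgen.transform a ξ = ξ.char.res a := rfl

theorem GeneratedByProj.transform_injective (hgen : GeneratedByProj A) :
    Function.Injective hgen.transform := by
  refine (injective_iff_map_eq_zero _).2 fun a ha => ?_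
  by_contra h0
  obtain ⟨χ, hχ⟩ := exists_char_apply_ne_zero h0
  rw [← hgen.res_char_ult ⟨χ, hgen.ones_nonempty hχ⟩, ← hgen.transform_apply, ha] at hχ
  exact hχ rfl

open scoped Classical in
/-- Extension by zero of a function on `Bhat A` to all characters of the unitization. -/
noncomputable def extendZero (f : Bhat A → ℂ) (χ : Char A) : ℂ :=
  if h : (ones χ.res).Nonempty then f (NonzeroChar.ult ⟨χ, h⟩) else 0

theorem extendZero_of_nonempty (f : Bhat A → ℂ) (χ : NonzeroChar A) :
    extendZero f χ.1 = f χ.ult := dif_pos χ.2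

theorem extendZero_of_not_nonempty (f : Bhat A → ℂ) {χ : Char A}
    (h : ¬ (ones χ.res).Nonempty) : extendZero f χ = 0 := dif_neg h

theorem isOpen_nonzeroChar : IsOpen {χ : Char A | (ones χ.res).Nonempty} := by
  have : {χ : Char A | (ones χ.res).Nonempty} = ⋃ p : Proj A, {χ | χ.res p ≠ 0} := by
    ext χ
    simp only [Set.mem_iUnion]
    refine exists_congr fun p => ?_
    change χ.res p = 1 ↔ χ.res p ≠ 0
    rcases apply_eq_zero_or_one χ.res p with h | h <;> simp [h]
  rw [this]
  exact isOpen_iUnion fun p => isOpen_ne_fun (Char.continuous_res_apply _) continuous_const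

theorem continuous_extendZero (f : C₀(Bhat A, ℂ)) : Continuous (extendZero f) := by
  refine continuous_iff_continuousAt.2 fun χ => ?_
  by_cases hχ : (ones χ.res).Nonempty
  · refine ContinuousOn.continuousAt (s := {χ : Char A | (ones χ.res).Nonempty}) ?_
      (isOpen_nonzeroChar.mem_nhds hχ)
    rw [continuousOn_iff_continuous_domRestrict]
    exact ((map_continuous f).comp NonzeroChar.continuous_ult).congr
      fun χ => (extendZero_of_nonempty f χ).symm
  · rw [ContinuousAt, extendZero_of_not_nonempty _ hχ]
    refine Metric.tendsto_nhds.2 fun ε hε => ?_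
    obtain ⟨t, ht, hft⟩ := mem_cocompact'.1 (Metric.tendsto_nhds.1 (zero_at_infty f) ε hε)
    obtain ⟨s, hs⟩ := ht.elim_finite_subcover (fun p : Proj A => {ξ : Bhat A | p ∈ ξ.1}) isOpen_Z
      fun ξ _ => Set.mem_iUnion.2 ξ.2.1.1
    have hnhds : ∀ᶠ χ' : Char A in 𝓝 χ, ∀ p ∈ s, χ'.res p ≠ 1 := by
      refine (eventually_all_finset s).2 fun p _ => ?_
      exact (isOpen_ne_fun (Char.continuous_res_apply (p : A)) continuous_const).mem_nhds
        fun h => hχ ⟨p, h⟩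
    filter_upwards [hnhds] with χ' hχ'
    by_cases h : (ones χ'.res).Nonempty
    · rw [extendZero_of_nonempty f ⟨χ', h⟩]
      by_contra hlt
      obtain ⟨p, hps, hp⟩ := Set.mem_iUnion₂.1 (hs (hft hlt))
      exact hχ' p hps hp
    · rwa [extendZero_of_not_nonempty _ h, dist_self]

theorem GeneratedByProj.transform_surjective (hgen : GeneratedByProj A) :
    Function.Surjective hgen.transform := by
  intro f
  obtain ⟨b, hb⟩ := (gelfandTransform_bijective (Unitization ℂ A)).2
    ⟨extendZero f, continuous_extendZero f⟩
  have hb' (χ : Char A) : χ b = extendZero f χ := DFunLike.congr_fun hb χ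
  let χ₀ : Char A := CharacterSpace.equivAlgHom.symm (Unitization.fstHom ℂ A)
  have hχ₀ (c : Unitization ℂ A) : χ₀ c = c.fst := rfl
  have hfst : b.fst = 0 := by
    rw [← hχ₀, hb']
    refine extendZero_of_not_nonempty _ ?_
    rintro ⟨p, hp⟩
    exact zero_ne_one hp
  refine ⟨b.snd, ?_⟩
  ext ξ
  have h := ξ.char.apply_eq b
  rw [hfst, zero_add, hb', extendZero_of_nonempty f ⟨ξ.char, ξ.char_nonempty⟩, ξ.ult_char] at h
  exact h.symm

variable (A)

/-- a commutative C*-algebra generated by its projections is isometrically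
*-isomorphic to `C₀(B̂, ℂ)`, where `B̂` is the Stone dual of its Boolean algebra of projections,
via an isomorphism sending each projection `p` to the characteristic function of
`Z(p) = {ξ : p ∈ ξ}`. -/
theorem stmt7
    (hgen : closure ((NonUnitalStarAlgebra.adjoin ℂ
        {p : A | star p = p ∧ p * p = p} : NonUnitalStarSubalgebra ℂ A) : Set A)
      = Set.univ) :
    ∃ Φ : A ≃⋆ₐ[ℂ] C₀(Bhat A, ℂ),
      (∀ a : A, ‖Φ a‖ = ‖a‖) ∧
      ∀ (p : Proj A) (ξ : Bhat A),
        Φ (p : A) ξ = Set.indicator {ζ : Bhat A | p ∈ ζ.val} (fun _ => (1 : ℂ)) ξ := by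
  have h : GeneratedByProj A := hgen
  let Φ := StarAlgEquiv.ofBijective h.transform ⟨h.transform_injective, h.transform_surjective⟩
  exact ⟨Φ, StarAlgEquiv.norm_map Φ, fun p ξ => Bhat.char_apply_proj p ξ⟩

end Stmt7
end

section
/- Let X be a locally compact Hausdorff space and let U be an open subset of X. Let I_U := {f ∈ C₀(X, ℂ) : f(x) = 0 for all x ∈ X \ U} (the closed ideal of C₀(X) corresponding to C₀(U)). Then U is closed in X if and only if there exists a closed ideal J of C₀(X, ℂ) such that C₀(X, ℂ) is the internal direct sum of I_U and J, i.e. I_U ∩ J = {0} and every f ∈ C₀(X, ℂ) can be written as f = g + h with g ∈ I_U and h ∈ J. -/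
open scoped ZeroAtInfty

namespace ZeroAtInftyContinuousMap

variable {X : Type*} [TopologicalSpace X]

theorem continuous_apply {E : Type*} [PseudoMetricSpace E] [Zero E] (x : X) :
    Continuous fun f : C₀(X, E) ↦ f x :=
  (continuous_eval_const (F := BoundedContinuousFunction X E) x).comp isometry_toBCF.continuous

/-- Extension by zero of the restriction of `f` to a clopen set. -/
noncomputable def indicator {U : Set X} (hU : IsClopen U) (f : C₀(X, ℂ)) : C₀(X, ℂ) where
  toFun := U.indicator f
  continuous_toFun := hU.continuous_indicator f.continuous
  zero_at_infty' := by
    refine squeeze_zero_norm (fun x ↦ norm_indicator_le_norm_self f x) ?_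
    simpa using (zero_at_infty f).norm

theorem exists_eq_one_of_mem_isOpen [LocallyCompactSpace X] [T2Space X] {U : Set X}
    (hU : IsOpen U) {x : X} (hx : x ∈ U) :
    ∃ f : C₀(X, ℂ), f x = 1 ∧ ∀ y ∉ U, f y = 0 := by
  obtain ⟨k, hk1, hk0, hkc, -⟩ := exists_continuous_one_zero_of_isCompact
    (isCompact_singleton (x := x)) hU.isClosed_compl (Set.disjoint_singleton_left.2 fun h ↦ h hx)
  have hc : HasCompactSupport fun y ↦ (k y : ℂ) := hkc.comp_left Complex.ofReal_zero
  refine ⟨⟨⟨fun y ↦ (k y : ℂ), by fun_prop⟩, hc.is_zero_at_infty⟩, ?_, fun y hy ↦ ?_⟩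
  · simpa using hk1 rfl
  · simpa using hk0 hy

/-- The ideal of functions vanishing on a set. -/
def vanishingOn (S : Set X) : Submodule ℂ C₀(X, ℂ) where
  carrier := {f | ∀ x ∈ S, f x = 0}
  add_mem' hf hg x hx := by simp [hf x hx, hg x hx]
  zero_mem' _ _ := rfl
  smul_mem' c f hf x hx := by simp [hf x hx]

theorem isClosed_vanishingOn (S : Set X) : IsClosed (vanishingOn S : Set C₀(X, ℂ)) := by
  have h : (vanishingOn S : Set C₀(X, ℂ)) = ⋂ x ∈ S, {f : C₀(X, ℂ) | f x = 0} := by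
    ext f
    simp only [Set.mem_iInter]
    rfl
  rw [h]
  exact isClosed_biInter fun x _ ↦ isClosed_eq (continuous_apply x) continuous_const

end ZeroAtInftyContinuousMap

/-- for a locally compact Hausdorff space `X` and an open `U ⊆ X`, the set
`U` is closed iff the ideal `I_U = {f ∈ C₀(X) : f ≡ 0 on X \ U}` admits a closed-ideal
complement `J`, i.e. `C₀(X) = I_U ⊕ J` internally. -/
theorem stmt10 {X : Type*} [TopologicalSpace X] [LocallyCompactSpace X] [T2Space X]
    (U : Set X) (hU : IsOpen U) :
    IsClosed U ↔
      ∃ J : Submodule ℂ C₀(X, ℂ),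
        IsClosed (J : Set C₀(X, ℂ)) ∧
        (∀ f : C₀(X, ℂ), ∀ h ∈ J, f * h ∈ J) ∧
        (∀ f : C₀(X, ℂ), (∀ x ∉ U, f x = 0) → f ∈ J → f = 0) ∧
        (∀ f : C₀(X, ℂ), ∃ g : C₀(X, ℂ), (∀ x ∉ U, g x = 0) ∧ ∃ h ∈ J, f = g + h) := by
  open ZeroAtInftyContinuousMap in
  constructor
  · intro hc
    refine ⟨vanishingOn U, isClosed_vanishingOn U, fun f h hh x hx ↦ ?_, fun f hf hfJ ↦ ?_,
      fun f ↦ ⟨indicator ⟨hc, hU⟩ f, fun x hx ↦ Set.indicator_of_notMem hx f,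
        f - indicator ⟨hc, hU⟩ f, fun x hx ↦ ?_, by abel⟩⟩
    · rw [mul_apply, hh x hx, mul_zero]
    · ext x
      by_cases hx : x ∈ U
      exacts [hfJ x hx, hf x hx]
    · exact sub_eq_zero.2 (Set.indicator_of_mem hx f).symm
  · rintro ⟨J, -, hmul, hinter, hsum⟩
    have hJ : ∀ h ∈ J, ∀ y ∈ U, h y = 0 := by
      intro h hh y hy
      obtain ⟨k, hky, hk⟩ := exists_eq_one_of_mem_isOpen hU hy
      have hkh : k * h = 0 := hinter _ (fun x hx ↦ by simp [hk x hx]) (hmul k h hh)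
      simpa [hky] using DFunLike.congr_fun hkh y
    refine isClosed_of_closure_subset fun x hx ↦ ?_
    by_contra hxU
    obtain ⟨f, hfx, -⟩ := exists_eq_one_of_mem_isOpen isOpen_univ (Set.mem_univ x)
    obtain ⟨g, hg, h, hh, rfl⟩ := hsum f
    have hx0 : h x = 0 :=
      closure_minimal (hJ h hh) (isClosed_eq h.continuous continuous_const) hx
    simp [hg x hxU, hx0] at hfx
end
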